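/- Let R be a commutative ring, d ≥ 2, and let F, G ∈ R[X,Y] be binary forms of degree d. Define the iterated pair by [F₁,G₁] = [F,G] and F_{n+1} = F(F_n, G_n), G_{n+1} = G(F_n, G_n), so that F_n, G_n are binary forms of degree dⁿ. Then for every n ≥ 1, Res_{dⁿ}(F_n, G_n) = Res_d(F,G)^{N_n}, where N_n = dⁿ(dⁿ−1)/(d(d−1)). -/

import Mathlib

open MvPolynomial

noncomputable section

variable {R : Type*} [CommRing R]

/-- The coefficient vector of a binary form of degree `e`:
entry `i` is the coefficient of `X^(e-i) * Y^i`. -/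
def coeffVec (e : ℕ) (F : MvPolynomial (Fin 2) R) (i : Fin (e + 1)) : R :=
  MvPolynomial.coeff (Finsupp.single 0 (e - (i : ℕ)) + Finsupp.single 1 (i : ℕ)) F

/-- The `2e × 2e` Sylvester matrix built from two coefficient sequences of length `e+1`. -/
def sylv (e : ℕ) (a b : Fin (e + 1) → R) : Matrix (Fin (e + e)) (Fin (e + e)) R :=
  Matrix.of fun i j =>
    if h : (i : ℕ) < e then
      if hj : (i : ℕ) ≤ (j : ℕ) ∧ (j : ℕ) ≤ (i : ℕ) + e then
        a ⟨(j : ℕ) - (i : ℕ), by omega⟩ else 0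
    else
      if hj : (i : ℕ) - e ≤ (j : ℕ) ∧ (j : ℕ) ≤ (i : ℕ) then
        b ⟨(j : ℕ) - ((i : ℕ) - e), by omega⟩ else 0

/-- The resultant of two binary forms of degree `e`
(the determinant of the `2e × 2e` Sylvester matrix). -/
def bres (e : ℕ) (F G : MvPolynomial (Fin 2) R) : R :=
  (sylv e (coeffVec e F) (coeffVec e G)).det

/-- Substitution of the pair of binary forms `(f, g)` into the binary form `F`. -/
def comp2 (F f g : MvPolynomial (Fin 2) R) : MvPolynomial (Fin 2) R :=
  MvPolynomial.aeval ![f, g] F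

/-- The iterated pair: `pairIter F G n` is the pair of binary forms of degree `dⁿ`
obtained by iterating the pair `(F, G)` (of degree `d`) `n` times;
`pairIter F G 0 = (X, Y)` and `pairIter F G 1 = (F, G)`. -/
def pairIter (F G : MvPolynomial (Fin 2) R) : ℕ → MvPolynomial (Fin 2) R × MvPolynomial (Fin 2) R
  | 0 => (X 0, X 1)
  | n + 1 => (comp2 F (pairIter F G n).1 (pairIter F G n).2,
              comp2 G (pairIter F G n).1 (pairIter F G n).2)


open Polynomial in
/-- The value `∑ a_k f ^ k g ^ (n - k)` of the degree-`n` homogenization of `p = ∑ a_k X ^ k`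
at `(f, g)`. -/
def homogEval (n : ℕ) (p f g : R[X]) : R[X] :=
  MvPolynomial.aeval ![f, g] (p.homogenize n)

namespace Polynomial

/-- `Res(f₁ * f₂, g) = Res(f₁, g) * Res(f₂, g)` for arbitrary formal degrees. -/
lemma resultant_mul_left_of_natDegree_le {f₁ f₂ g : R[X]} {m₁ m₂ n : ℕ}
    (h₁ : f₁.natDegree ≤ m₁) (h₂ : f₂.natDegree ≤ m₂) (hg : g.natDegree ≤ n) :
    resultant (f₁ * f₂) g (m₁ + m₂) n = resultant f₁ g m₁ n * resultant f₂ g m₂ n := by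
  obtain ⟨k₁, rfl⟩ := Nat.exists_eq_add_of_le h₁
  obtain ⟨k₂, rfl⟩ := Nat.exists_eq_add_of_le h₂
  rw [show f₁.natDegree + k₁ + (f₂.natDegree + k₂)
      = (f₁.natDegree + f₂.natDegree) + (k₁ + k₂) by ring,
    resultant_add_left_deg _ _ _ _ _ natDegree_mul_le, resultant_mul_left _ _ _ _ hg,
    resultant_add_left_deg _ _ _ _ _ le_rfl, resultant_add_left_deg _ _ _ _ _ le_rfl]
  ring

/-- `Res(f, g ^ k) = Res(f, g) ^ k` for arbitrary formal degrees. -/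
lemma resultant_pow_right_of_natDegree_le {f g : R[X]} {m n : ℕ}
    (hf : f.natDegree ≤ m) (hg : g.natDegree ≤ n) (k : ℕ) :
    resultant f (g ^ k) m (k * n) = resultant f g m n ^ k := by
  induction k with
  | zero => simp
  | succ k ih =>
    rw [resultant_comm, pow_succ, Nat.succ_mul,
      resultant_mul_left_of_natDegree_le (natDegree_pow_le_of_le k hg) hg hf,
      resultant_comm, resultant_comm g, ih, pow_succ]
    have h (a : ℕ) : ((-1 : R) ^ a) * (-1) ^ a = 1 := by
      rw [← mul_pow]; simp
    have e : ((-1 : R)) ^ (m * (k * n + n)) = (-1) ^ (k * n * m) * (-1) ^ (n * m) := by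
      rw [← pow_add]; ring_nf
    rw [e]
    linear_combination
      (resultant f g m n ^ k * resultant f g m n * ((-1) ^ (n * m) * (-1) ^ (n * m))) *
        h (k * n * m) + (resultant f g m n ^ k * resultant f g m n) * h (n * m)

end Polynomial

namespace homogEval

open Polynomial Finset.HasAntidiagonal

lemma add (n : ℕ) (p q f g : R[X]) :
    homogEval n (p + q) f g = homogEval n p f g + homogEval n q f g := by
  simp [homogEval]

lemma mul {m n : ℕ} {p q : R[X]} (hp : p.natDegree ≤ m) (hq : q.natDegree ≤ n) (f g : R[X]) :
    homogEval (m + n) (p * q) f g = homogEval m p f g * homogEval n q f g := by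
  simp [homogEval, homogenize_mul p q hp hq]

lemma const (n : ℕ) (c : R) (f g : R[X]) :
    homogEval n (Polynomial.C c) f g = Polynomial.C c * g ^ n := by
  simp [homogEval]

lemma one (n : ℕ) (f g : R[X]) : homogEval n 1 f g = g ^ n := by
  simp [homogEval]

lemma C_mul_X_pow (n : ℕ) (c : R) (f g : R[X]) :
    homogEval n (Polynomial.C c * Polynomial.X ^ n) f g = Polynomial.C c * f ^ n := by
  simp [homogEval]

lemma X_sub_C (r : R) (f g : R[X]) :
    homogEval 1 (Polynomial.X - Polynomial.C r) f g = f - Polynomial.C r * g := by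
  rw [sub_eq_add_neg, ← Polynomial.C_neg, add, const]
  simp [homogEval, sub_eq_add_neg]

lemma eq_sum (n : ℕ) (p f g : R[X]) :
    homogEval n p f g =
      ∑ kl ∈ antidiagonal n, Polynomial.C (p.coeff kl.1) * (f ^ kl.1 * g ^ kl.2) := by
  simp [homogEval, homogenize, MvPolynomial.aeval_monomial, Finsupp.prod_fintype, Fin.prod_univ_two]

lemma natDegree_le {n e : ℕ} {f g : R[X]} (p : R[X]) (hf : f.natDegree ≤ e)
    (hg : g.natDegree ≤ e) : (homogEval n p f g).natDegree ≤ n * e := by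
  rw [eq_sum]
  refine natDegree_sum_le_of_forall_le _ _ fun kl hkl => ?_
  rw [← mem_antidiagonal.mp hkl, add_mul]
  exact (natDegree_C_mul_le _ _).trans (natDegree_mul_le_of_le
    (natDegree_pow_le_of_le _ hf) (natDegree_pow_le_of_le _ hg))

lemma polynomial_map {S : Type*} [CommRing S] (φ : R →+* S) (n : ℕ) (p f g : R[X]) :
    homogEval n (p.map φ) (f.map φ) (g.map φ) = (homogEval n p f g).map φ := by
  simp [eq_sum, Polynomial.map_sum]

/-- Reduction of the second form modulo `f - r g`. -/
lemma resultant_X_sub_C {d e : ℕ} (r : R) {q f g : R[X]} (hq : q.natDegree ≤ d + 1)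
    (hf : f.natDegree ≤ e) (hg : g.natDegree ≤ e) :
    resultant (homogEval 1 (Polynomial.X - Polynomial.C r) f g) (homogEval (d + 1) q f g)
        (1 * e) ((d + 1) * e) =
      resultant (Polynomial.X - Polynomial.C r) q 1 (d + 1) ^ e *
        resultant f g e e ^ (1 * (d + 1)) := by
  nontriviality R
  have hdiv : q = Polynomial.C (q.eval r) +
      (Polynomial.X - Polynomial.C r) * (q /ₘ (Polynomial.X - Polynomial.C r)) := by
    conv_lhs => rw [← modByMonic_add_div q (Polynomial.X - Polynomial.C r),
      modByMonic_X_sub_C_eq_C_eval]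
  have hdeg : (q /ₘ (Polynomial.X - Polynomial.C r)).natDegree ≤ d := by
    rw [natDegree_divByMonic _ (monic_X_sub_C r), natDegree_X_sub_C]; omega
  have hL : (f - Polynomial.C r * g).natDegree ≤ e :=
    (natDegree_sub_le_of_le hf ((natDegree_C_mul_le r g).trans hg)).trans (by simp)
  have hexp : homogEval (d + 1) q f g = Polynomial.C (q.eval r) * g ^ (d + 1) +
      (f - Polynomial.C r * g) *
        homogEval d (q /ₘ (Polynomial.X - Polynomial.C r)) f g := by
    conv_lhs => rw [hdiv]
    rw [add, const, add_comm d 1, mul (by simp) hdeg, X_sub_C]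
  rw [resultant_X_sub_C_left _ _ _ hq, hexp, X_sub_C, one_mul, one_mul,
    resultant_add_mul_right _ _ _ _ _
      (by have := natDegree_le (n := d) (q /ₘ (Polynomial.X - Polynomial.C r)) hf hg
          rw [Nat.succ_mul]; omega) hL,
    resultant_C_mul_right, resultant_pow_right_of_natDegree_le hL hg]
  congr 2
  have := resultant_add_mul_left f g (Polynomial.C (-r)) e e (by simp) hg
  rw [← this]
  congr 1
  simp; ring

/-- Reduction of the second form modulo `g`. -/
lemma resultant_one {d e : ℕ} {q f g : R[X]} (hq : q.natDegree ≤ d + 1)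
    (hf : f.natDegree ≤ e) (hg : g.natDegree ≤ e) :
    resultant (homogEval 1 1 f g) (homogEval (d + 1) q f g) (1 * e) ((d + 1) * e) =
      resultant 1 q 1 (d + 1) ^ e * resultant f g e e ^ (1 * (d + 1)) := by
  have hdeg : (q - Polynomial.C (q.coeff (d + 1)) * Polynomial.X ^ (d + 1)).natDegree ≤ d := by
    rw [natDegree_le_iff_coeff_eq_zero]
    intro N hN
    rcases eq_or_lt_of_le (Nat.succ_le_of_lt hN) with rfl | h
    · simp
    · simp [coeff_eq_zero_of_natDegree_lt (hq.trans_lt h), Polynomial.coeff_X_pow, h.ne']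
  have hexp : homogEval (d + 1) q f g = Polynomial.C (q.coeff (d + 1)) * f ^ (d + 1) +
      g * homogEval d (q - Polynomial.C (q.coeff (d + 1)) * Polynomial.X ^ (d + 1)) f g := by
    conv_lhs => rw [← add_sub_cancel (Polynomial.C (q.coeff (d + 1)) * Polynomial.X ^ (d + 1)) q,
      ← one_mul (q - _)]
    rw [add, C_mul_X_pow, add_comm d 1, mul (by simp) (by rwa [add_comm 1 d]), one, pow_one]
  rw [hexp, one, one_mul, pow_one, one_mul,
    resultant_add_mul_right _ _ _ _ _
      (by have := natDegree_le (n := d)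
            (q - Polynomial.C (q.coeff (d + 1)) * Polynomial.X ^ (d + 1)) hf hg
          rw [Nat.succ_mul]; omega) hg,
    resultant_C_mul_right, resultant_pow_right_of_natDegree_le hg hf, resultant_one_left,
    resultant_comm g, mul_pow, mul_pow]
  have : ((-1 : R) ^ (e * e)) = (-1) ^ e := by
    rcases Nat.even_or_odd e with h | h
    · rw [h.neg_one_pow, (h.mul_left e).neg_one_pow]
    · rw [h.neg_one_pow, (h.mul h).neg_one_pow]
  rw [this]
  ring

/-- Multiplicativity in the first form of the composition formula. -/
lemma resultant_mul {m₁ m₂ d e : ℕ} {p₁ p₂ q f g : R[X]} (h₁ : p₁.natDegree ≤ m₁)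
    (h₂ : p₂.natDegree ≤ m₂) (hq : q.natDegree ≤ d)
    (hf : f.natDegree ≤ e) (hg : g.natDegree ≤ e)
    (H₁ : resultant (homogEval m₁ p₁ f g) (homogEval d q f g) (m₁ * e) (d * e) =
      resultant p₁ q m₁ d ^ e * resultant f g e e ^ (m₁ * d))
    (H₂ : resultant (homogEval m₂ p₂ f g) (homogEval d q f g) (m₂ * e) (d * e) =
      resultant p₂ q m₂ d ^ e * resultant f g e e ^ (m₂ * d)) :
    resultant (homogEval (m₁ + m₂) (p₁ * p₂) f g) (homogEval d q f g)
        ((m₁ + m₂) * e) (d * e) =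
      resultant (p₁ * p₂) q (m₁ + m₂) d ^ e * resultant f g e e ^ ((m₁ + m₂) * d) := by
  rw [mul h₁ h₂, add_mul, resultant_mul_left_of_natDegree_le (natDegree_le _ hf hg)
    (natDegree_le _ hf hg) (natDegree_le _ hf hg), H₁, H₂,
    resultant_mul_left_of_natDegree_le h₁ h₂ hq]
  ring

lemma resultant_const {d e : ℕ} (c : R) (q f g : R[X]) :
    resultant (homogEval 0 (Polynomial.C c) f g) (homogEval d q f g) (0 * e) (d * e) =
      resultant (Polynomial.C c) q 0 d ^ e * resultant f g e e ^ (0 * d) := by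
  simp [const, pow_mul]

lemma resultant_one_add {k d e : ℕ} {q f g : R[X]} (hq : q.natDegree ≤ d + 1)
    (hf : f.natDegree ≤ e) (hg : g.natDegree ≤ e) :
    resultant (homogEval k 1 f g) (homogEval (d + 1) q f g) (k * e) ((d + 1) * e) =
      resultant 1 q k (d + 1) ^ e * resultant f g e e ^ (k * (d + 1)) := by
  induction k with
  | zero => simpa using resultant_const (e := e) (d := d + 1) 1 q f g
  | succ k ih =>
    have h := resultant_mul (m₁ := k) (m₂ := 1) (p₁ := 1) (p₂ := 1) (by simp) (by simp) hq hf hg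
      ih (resultant_one hq hf hg)
    rwa [mul_one] at h

lemma resultant_of_splits {K : Type*} [Field K] {d e : ℕ} {p : K[X]} (hp : p.Splits)
    {q f g : K[X]} (hq : q.natDegree ≤ d + 1)
    (hf : f.natDegree ≤ e) (hg : g.natDegree ≤ e) :
    resultant (homogEval p.natDegree p f g) (homogEval (d + 1) q f g)
        (p.natDegree * e) ((d + 1) * e) =
      resultant p q p.natDegree (d + 1) ^ e * resultant f g e e ^ (p.natDegree * (d + 1)) := by
  have key (s : Multiset K) :
      ∀ P : K[X], P = (s.map fun a => Polynomial.X - Polynomial.C a).prod →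
      resultant (homogEval s.card P f g) (homogEval (d + 1) q f g)
        (s.card * e) ((d + 1) * e) =
      resultant P q s.card (d + 1) ^ e * resultant f g e e ^ (s.card * (d + 1)) := by
    induction s using Multiset.induction_on with
    | empty => rintro _ rfl; simpa using resultant_const (e := e) (d := d + 1) 1 q f g
    | cons a s ih =>
      rintro _ rfl
      rw [Multiset.map_cons, Multiset.prod_cons, Multiset.card_cons, add_comm s.card 1]
      exact resultant_mul (by simp) (natDegree_multiset_prod_X_sub_C_eq_card s).le hq hf hg
        (resultant_X_sub_C a hq hf hg) (ih _ rfl)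
  have h := resultant_mul (p₁ := Polynomial.C p.leadingCoeff) (by simp)
    (natDegree_multiset_prod_X_sub_C_eq_card p.roots).le hq hf hg
    (resultant_const (e := e) (d := d + 1) p.leadingCoeff q f g) (key p.roots _ rfl)
  rwa [← hp.eq_prod_roots, zero_add, ← hp.natDegree_eq_card_roots] at h

/-- The composition formula
`Res(p(f, g), q(f, g)) = Res(p, q) ^ e * Res(f, g) ^ (m * n)` for binary forms `p, q` of
degrees `m, n` and binary forms `f, g` of degree `e`. -/
lemma resultant_comp (p : R[X]) : ∀ (m d e : ℕ) (q f g : R[X]), p.natDegree ≤ m →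
    q.natDegree ≤ d + 1 → f.natDegree ≤ e → g.natDegree ≤ e →
    resultant (homogEval m p f g) (homogEval (d + 1) q f g) (m * e) ((d + 1) * e) =
      resultant p q m (d + 1) ^ e * resultant f g e e ^ (m * (d + 1)) := by
  induction p using induction_of_Splits_of_injective_of_surjective with
  | Splits K p hp =>
    intro m d e q f g hm hq hf hg
    obtain ⟨k, rfl⟩ := Nat.exists_eq_add_of_le hm
    have h := resultant_mul (p₂ := 1) le_rfl (by simp) hq hf hg
      (resultant_of_splits hp hq hf hg) (resultant_one_add (k := k) hq hf hg)
    rwa [mul_one] at h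
  | injective A B φ hφ p IH =>
    intro m d e q f g hm hq hf hg
    apply hφ
    have := IH m d e (q.map φ) (f.map φ) (g.map φ) (natDegree_map_le.trans hm)
      (natDegree_map_le.trans hq) (natDegree_map_le.trans hf) (natDegree_map_le.trans hg)
    rw [polynomial_map, polynomial_map] at this
    simpa only [resultant_map_map, ← map_pow, ← map_mul] using this
  | surjective A B φ hφ p IH =>
    intro m d e q f g hm hq hf hg
    obtain ⟨p', rfl, ep⟩ := exists_natDegree_eq_of_mem_lifts (Polynomial.map_surjective φ hφ p)
    obtain ⟨q', rfl, eq⟩ := exists_natDegree_eq_of_mem_lifts (Polynomial.map_surjective φ hφ q)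
    obtain ⟨f', rfl, ef⟩ := exists_natDegree_eq_of_mem_lifts (Polynomial.map_surjective φ hφ f)
    obtain ⟨g', rfl, eg⟩ := exists_natDegree_eq_of_mem_lifts (Polynomial.map_surjective φ hφ g)
    rw [polynomial_map, polynomial_map]
    simp only [resultant_map_map, ← map_pow, ← map_mul]
    rw [IH p' m d e q' f' g' (ep ▸ hm) (eq ▸ hq) (ef ▸ hf) (eg ▸ hg)]

end homogEval

/-- The dehomogenization `F(X, 1)` of a binary form. -/
def dehomogenize (F : MvPolynomial (Fin 2) R) : Polynomial R :=
  MvPolynomial.aeval ![Polynomial.X, 1] F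

lemma homogenize_dehomogenize {e : ℕ} {F : MvPolynomial (Fin 2) R} (hF : F.IsHomogeneous e) :
    (dehomogenize F).homogenize e = F :=
  Polynomial.homogenize_eq_of_isHomogeneous hF rfl

lemma natDegree_dehomogenize_le {e : ℕ} {F : MvPolynomial (Fin 2) R} (hF : F.IsHomogeneous e) :
    (dehomogenize F).natDegree ≤ e := by
  have := homogEval.natDegree_le (n := e) (e := 1) (dehomogenize F)
    (f := Polynomial.X) (g := 1) Polynomial.natDegree_X_le (by simp)
  rwa [homogEval, homogenize_dehomogenize hF, mul_one] at this

lemma coeff_dehomogenize {e : ℕ} {F : MvPolynomial (Fin 2) R} (hF : F.IsHomogeneous e)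
    {i : ℕ} (hi : i ≤ e) :
    (dehomogenize F).coeff (e - i) =
      F.coeff (Finsupp.single 0 (e - i) + Finsupp.single 1 i) := by
  conv_rhs => rw [← homogenize_dehomogenize hF, Polynomial.coeff_homogenize]
  simp [hi]

lemma bres_eq_resultant {e : ℕ} {F G : MvPolynomial (Fin 2) R} (hF : F.IsHomogeneous e)
    (hG : G.IsHomogeneous e) :
    bres e F G = Polynomial.resultant (dehomogenize F) (dehomogenize G) e e := by
  rw [bres, Polynomial.resultant, ← Matrix.det_transpose,
    ← Matrix.det_submatrix_equiv_self Fin.revPerm]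
  congr 1
  ext i j
  have hi := i.2
  induction j using Fin.addCases with
  | left j =>
    have hj := j.2
    have h1 : ¬ (e + e - (j + 1) < e) := by omega
    simp only [Matrix.submatrix_apply, Matrix.transpose_apply, sylv, Polynomial.sylvester,
      Matrix.of_apply, Fin.addCases_left, Fin.revPerm_apply, Fin.val_rev, Fin.val_castAdd,
      Set.mem_Icc, h1, dite_false, coeffVec]
    by_cases h : (j : ℕ) ≤ i ∧ (i : ℕ) ≤ j + e
    · rw [dif_pos (by omega), if_pos h, ← coeff_dehomogenize hG (by omega)]
      congr 1; omega
    · rw [dif_neg (by omega), if_neg h]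
  | right j =>
    have hj := j.2
    have h1 : e + e - (e + j + 1) < e := by omega
    simp only [Matrix.submatrix_apply, Matrix.transpose_apply, sylv, Polynomial.sylvester,
      Matrix.of_apply, Fin.addCases_right, Fin.revPerm_apply, Fin.val_rev, Fin.val_natAdd,
      Set.mem_Icc, h1, dite_true, coeffVec]
    by_cases h : (j : ℕ) ≤ i ∧ (i : ℕ) ≤ j + e
    · rw [dif_pos (by omega), if_pos h, ← coeff_dehomogenize hF (by omega)]
      congr 1; omega
    · rw [dif_neg (by omega), if_neg h]

lemma isHomogeneous_comp2 {d e : ℕ} {F f g : MvPolynomial (Fin 2) R} (hF : F.IsHomogeneous d)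
    (hf : f.IsHomogeneous e) (hg : g.IsHomogeneous e) :
    (comp2 F f g).IsHomogeneous (d * e) := by
  rw [mul_comm]
  refine hF.aeval ![f, g] (fun i => ?_)
  fin_cases i
  exacts [hf, hg]

lemma dehomogenize_comp2 {d : ℕ} {F : MvPolynomial (Fin 2) R} (hF : F.IsHomogeneous d)
    (f g : MvPolynomial (Fin 2) R) :
    dehomogenize (comp2 F f g) =
      homogEval d (dehomogenize F) (dehomogenize f) (dehomogenize g) := by
  rw [homogEval, homogenize_dehomogenize hF, dehomogenize, comp2, ← AlgHom.comp_apply]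
  congr 1
  ext i : 1
  fin_cases i <;> simp [dehomogenize]

/-- The resultant of a composition of pairs of binary forms of degrees `d` and `e`. -/
lemma bres_comp2 {d e : ℕ} (hd : d ≠ 0) {F G f g : MvPolynomial (Fin 2) R}
    (hF : F.IsHomogeneous d) (hG : G.IsHomogeneous d)
    (hf : f.IsHomogeneous e) (hg : g.IsHomogeneous e) :
    bres (d * e) (comp2 F f g) (comp2 G f g) = bres d F G ^ e * bres e f g ^ (d * d) := by
  obtain ⟨k, rfl⟩ := Nat.exists_eq_succ_of_ne_zero hd
  rw [bres_eq_resultant (isHomogeneous_comp2 hF hf hg) (isHomogeneous_comp2 hG hf hg),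
    bres_eq_resultant hF hG, bres_eq_resultant hf hg, dehomogenize_comp2 hF,
    dehomogenize_comp2 hG]
  exact homogEval.resultant_comp _ _ _ _ _ _ _ (natDegree_dehomogenize_le hF)
    (natDegree_dehomogenize_le hG) (natDegree_dehomogenize_le hf) (natDegree_dehomogenize_le hg)

lemma isHomogeneous_pairIter {d : ℕ} {F G : MvPolynomial (Fin 2) R} (hF : F.IsHomogeneous d)
    (hG : G.IsHomogeneous d) (n : ℕ) :
    (pairIter F G n).1.IsHomogeneous (d ^ n) ∧ (pairIter F G n).2.IsHomogeneous (d ^ n) := by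
  induction n with
  | zero => exact ⟨isHomogeneous_X R 0, isHomogeneous_X R 1⟩
  | succ n ih =>
    rw [pow_succ']
    exact ⟨isHomogeneous_comp2 hF ih.1 ih.2, isHomogeneous_comp2 hG ih.1 ih.2⟩

lemma exists_bres_pairIter_eq_pow {d : ℕ} (hd : d ≠ 0) {F G : MvPolynomial (Fin 2) R}
    (hF : F.IsHomogeneous d) (hG : G.IsHomogeneous d) {n : ℕ} (hn : 1 ≤ n) :
    ∃ N : ℕ, d ^ n * (d ^ n - 1) = d * (d - 1) * N ∧
      bres (d ^ n) (pairIter F G n).1 (pairIter F G n).2 = bres d F G ^ N := by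
  induction n, hn using Nat.le_induction with
  | base =>
    refine ⟨1, by simp, ?_⟩
    have h (H : MvPolynomial (Fin 2) R) : comp2 H (X 0) (X 1) = H := by
      rw [comp2, show (![X 0, X 1] : Fin 2 → MvPolynomial (Fin 2) R) = X by
        ext1 i; fin_cases i <;> rfl, aeval_X_left_apply]
    simp [pairIter, h]
  | succ n hn ih =>
    obtain ⟨N, hN, hres⟩ := ih
    obtain ⟨h1, h2⟩ := isHomogeneous_pairIter hF hG n
    refine ⟨d ^ n + N * (d * d), ?_, ?_⟩
    · have hd1 : 1 ≤ d := Nat.one_le_iff_ne_zero.mpr hd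
      have hdn : 1 ≤ d ^ n := Nat.one_le_pow _ _ hd1
      have hdn1 : 1 ≤ d ^ (n + 1) := Nat.one_le_pow _ _ hd1
      zify [hd1, hdn, hdn1] at hN ⊢
      linear_combination (d : ℤ) ^ 2 * hN
    · rw [pow_succ', pairIter, bres_comp2 hd hF hG h1 h2, hres]
      ring

/-- For binary forms `F, G` of degree `d ≥ 2` over a commutative ring, with
iterated pair `F_{n+1} = F(F_n, G_n)`, `G_{n+1} = G(F_n, G_n)`, the iterates `F_n, G_n` are
binary forms of degree `dⁿ` and for every `n ≥ 1`,
`Res_{dⁿ}(F_n, G_n) = Res_d(F,G)^{N_n}` with `N_n = dⁿ(dⁿ−1)/(d(d−1))`. -/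
theorem resultant_of_iterates {R : Type*} [CommRing R] (d : ℕ) (hd : 2 ≤ d)
    (F G : MvPolynomial (Fin 2) R) (hF : F.IsHomogeneous d) (hG : G.IsHomogeneous d)
    (n : ℕ) (hn : 1 ≤ n) :
    (pairIter F G n).1.IsHomogeneous (d ^ n) ∧ (pairIter F G n).2.IsHomogeneous (d ^ n) ∧
      bres (d ^ n) (pairIter F G n).1 (pairIter F G n).2 =
        bres d F G ^ (d ^ n * (d ^ n - 1) / (d * (d - 1))) := by
  obtain ⟨h1, h2⟩ := isHomogeneous_pairIter hF hG n
  obtain ⟨N, hN, hres⟩ := exists_bres_pairIter_eq_pow (by omega) hF hG hn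
  refine ⟨h1, h2, ?_⟩
  rw [hres, Nat.div_eq_of_eq_mul_right (Nat.mul_pos (by omega) (by omega)) hN]

end
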